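/- arXiv:1505.04182 — 3 statements merged into one kernel-verified Lean document; each statement's English description precedes it below -/
import Mathlib

section
/- Let φ(r,s) = (√(1 − (r² − s²)) + s)² / ((1 − r²)²·√(1 − (r² − s²))) (the Berwald function) and set ψ(r,s) := (s·φ_r(r,s) + r·φ_s(r,s))/(2r·φ(r,s)). Then at every point (r,s) with 0 < r < 1 and s² ≤ r², one has ψ(r,s)² − (s·ψ_r(r,s) + r·ψ_s(r,s))/r = 0. (This is the constant–flag–curvature equation R₁ = Kφ² with K = 0 for Berwald's metric.) -/
open Real

/-- Partial derivative in the first variable. -/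
noncomputable def pd1 (f : ℝ → ℝ → ℝ) (r s : ℝ) : ℝ := deriv (fun t => f t s) r

/-- Partial derivative in the second variable. -/
noncomputable def pd2 (f : ℝ → ℝ → ℝ) (r s : ℝ) : ℝ := deriv (fun t => f r t) s

/-- ψ := (s·φ_r + r·φ_s)/(2rφ). -/
noncomputable def psiFun (φ : ℝ → ℝ → ℝ) (r s : ℝ) : ℝ :=
  (s * pd1 φ r s + r * pd2 φ r s) / (2 * r * φ r s)

/-- The Berwald function φ(r,s) = (√(1 − (r² − s²)) + s)²/((1 − r²)²·√(1 − (r² − s²))). -/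
noncomputable def berwaldPhi : ℝ → ℝ → ℝ :=
  fun r s => (Real.sqrt (1 - (r ^ 2 - s ^ 2)) + s) ^ 2 /
    ((1 - r ^ 2) ^ 2 * Real.sqrt (1 - (r ^ 2 - s ^ 2)))

lemma abs_lt_sqrt_one_sub {r : ℝ} (s : ℝ) (hr0 : 0 < r) (hr1 : r < 1) :
    |s| < √(1 - (r ^ 2 - s ^ 2)) := by
  rw [← Real.sqrt_sq_eq_abs]
  exact Real.sqrt_lt_sqrt (sq_nonneg s) (by nlinarith)

lemma sqrt_one_sub_pos {r : ℝ} (s : ℝ) (hr0 : 0 < r) (hr1 : r < 1) :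
    0 < √(1 - (r ^ 2 - s ^ 2)) :=
  (abs_nonneg s).trans_lt (abs_lt_sqrt_one_sub s hr0 hr1)

lemma hasDerivAt_sqrt_fst {r s : ℝ} (hr0 : 0 < r) (hr1 : r < 1) :
    HasDerivAt (fun t => √(1 - (t ^ 2 - s ^ 2))) (-r / √(1 - (r ^ 2 - s ^ 2))) r := by
  have hw := sqrt_one_sub_pos s hr0 hr1
  convert ((hasDerivAt_pow 2 r).sub_const (s ^ 2)).const_sub 1 |>.sqrt
    (Real.sqrt_pos.mp hw).ne' using 1
  generalize √(1 - (r ^ 2 - s ^ 2)) = w at *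
  push_cast
  field_simp

lemma hasDerivAt_sqrt_snd {r s : ℝ} (hr0 : 0 < r) (hr1 : r < 1) :
    HasDerivAt (fun t => √(1 - (r ^ 2 - t ^ 2))) (s / √(1 - (r ^ 2 - s ^ 2))) s := by
  have hw := sqrt_one_sub_pos s hr0 hr1
  convert ((hasDerivAt_pow 2 s).const_sub (r ^ 2)).const_sub 1 |>.sqrt
    (Real.sqrt_pos.mp hw).ne' using 1
  generalize √(1 - (r ^ 2 - s ^ 2)) = w at *
  push_cast
  field_simp

lemma psiFun_berwaldPhi {r : ℝ} (s : ℝ) (hr0 : 0 < r) (hr1 : r < 1) :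
    psiFun berwaldPhi r s = (√(1 - (r ^ 2 - s ^ 2)) - s)⁻¹ := by
  have hw := sqrt_one_sub_pos s hr0 hr1
  obtain ⟨hneg, hlt⟩ := abs_lt.mp (abs_lt_sqrt_one_sub s hr0 hr1)
  have hsq := Real.sq_sqrt (Real.sqrt_pos.mp hw).le
  have hr : 0 < 1 - r ^ 2 := by nlinarith
  have h1 := (((hasDerivAt_sqrt_fst (s := s) hr0 hr1).add_const s).pow 2).div
    (((((hasDerivAt_id r).pow 2).const_sub 1).pow 2).mul (hasDerivAt_sqrt_fst (s := s) hr0 hr1))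
    (mul_pos (pow_pos hr 2) hw).ne'
  have h2 := (((hasDerivAt_sqrt_snd (s := s) hr0 hr1).add (hasDerivAt_id s)).pow 2).div
    ((hasDerivAt_sqrt_snd (s := s) hr0 hr1).const_mul ((1 - r ^ 2) ^ 2))
    (mul_pos (pow_pos hr 2) hw).ne'
  have e1 : pd1 berwaldPhi r s = _ := h1.deriv
  have e2 : pd2 berwaldPhi r s = _ := h2.deriv
  rw [psiFun, e1, e2, berwaldPhi]
  simp only [id, Pi.pow_apply, Pi.add_apply, Pi.mul_apply]
  generalize √(1 - (r ^ 2 - s ^ 2)) = w at *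
  have hp : w + s ≠ 0 := by linarith
  have hm : w - s ≠ 0 := by linarith
  have hfac : 1 - r ^ 2 = (w + s) * (w - s) := by linarith
  rw [hfac]
  field_simp
  norm_num
  ring

/-- Berwald's metric has zero flag curvature: ψ² − (sψ_r + rψ_s)/r = 0. -/
theorem berwald_zero_curvature (r s : ℝ) (hr0 : 0 < r) (hr1 : r < 1) (hs : s ^ 2 ≤ r ^ 2) :
    (psiFun berwaldPhi r s) ^ 2
      - (s * pd1 (psiFun berwaldPhi) r s + r * pd2 (psiFun berwaldPhi) r s) / r = 0 := by
  have hw := sqrt_one_sub_pos s hr0 hr1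
  have hm : √(1 - (r ^ 2 - s ^ 2)) - s ≠ 0 :=
    (sub_pos.mpr (abs_lt.mp (abs_lt_sqrt_one_sub s hr0 hr1)).2).ne'
  have h1 : pd1 (psiFun berwaldPhi) r s = _ :=
    (((hasDerivAt_sqrt_fst hr0 hr1).sub_const s).fun_inv hm |>.congr_of_eventuallyEq <| by
      filter_upwards [Ioo_mem_nhds hr0 hr1] with t ht
      exact psiFun_berwaldPhi s ht.1 ht.2).deriv
  have h2 : pd2 (psiFun berwaldPhi) r s = _ :=
    (((hasDerivAt_sqrt_snd hr0 hr1).sub (hasDerivAt_id s)).inv hm |>.congr_of_eventuallyEq <|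
      .of_forall fun t => psiFun_berwaldPhi t hr0 hr1).deriv
  rw [h1, h2, psiFun_berwaldPhi s hr0 hr1]
  simp only [id, Pi.sub_apply]
  field_simp
  ring
end

section
/- Let C and D ≠ 0 be constants, and define φ(r,s) := (1/2)·[ 1/(√(C + 2D − r² + s²) − s) − 1/(√(C − 2D − r² + s²) − s) ] on a region where r > 0, C + 2D − r² + s² > 0, C − 2D − r² + s² > 0, both √(C ± 2D − r² + s²) − s are nonzero, and φ > 0. Then φ satisfies both: (i) φ_r − s·φ_{rs} − r·φ_{ss} = 0, and (ii) −φ² = ψ² − (s·ψ_r + r·ψ_s)/r, where ψ := (s·φ_r + r·φ_s)/(2rφ). (Hence the corresponding spherically symmetric metric is projectively flat with constant flag curvature −1; these are the metrics first given by Z. Shen.) -/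
open Real

/-- Solution 2 of the Shen–Yu classification (K = −1, D ≠ 0), Z. Shen's metrics:
φ = (1/2)·[1/(√(C + 2D − r² + s²) − s) − 1/(√(C − 2D − r² + s²) − s)]. -/
noncomputable def shenSolPhi (C D : ℝ) : ℝ → ℝ → ℝ :=
  fun r s => (1 / 2) * (1 / (Real.sqrt (C + 2 * D - r ^ 2 + s ^ 2) - s)
    - 1 / (Real.sqrt (C - 2 * D - r ^ 2 + s ^ 2) - s))

open Filter Topology in
lemma pd1_congr {f g : ℝ → ℝ → ℝ} {r s : ℝ}
    (h : Function.uncurry f =ᶠ[𝓝 (r, s)] Function.uncurry g) :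
    pd1 f r s = pd1 g r s :=
  EventuallyEq.deriv_eq <|
    (show Continuous fun t : ℝ => (t, s) by fun_prop).continuousAt.eventually h

open Filter Topology in
lemma pd2_congr {f g : ℝ → ℝ → ℝ} {r s : ℝ}
    (h : Function.uncurry f =ᶠ[𝓝 (r, s)] Function.uncurry g) :
    pd2 f r s = pd2 g r s :=
  EventuallyEq.deriv_eq <|
    (show Continuous fun t : ℝ => (r, t) by fun_prop).continuousAt.eventually h

/-- The radical `√(E - r² + s²)` occurring in Shen's metrics. -/
noncomputable def shenRoot (E r s : ℝ) : ℝ := √(E - r ^ 2 + s ^ 2)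

/-- The points at which `1 / (shenRoot E r s - s)` is smooth. -/
def ShenRegular (E r s : ℝ) : Prop := 0 < E - r ^ 2 + s ^ 2 ∧ shenRoot E r s - s ≠ 0

/-- The building block `1 / (√(E - r² + s²) - s)` of Shen's metrics. -/
noncomputable def shenTerm (E r s : ℝ) : ℝ := 1 / (shenRoot E r s - s)

lemma shenSolPhi_eq (C D r s : ℝ) : shenSolPhi C D r s =
    (1 / 2) * (shenTerm (C + 2 * D) r s - shenTerm (C - 2 * D) r s) := rfl

lemma continuous_shenRoot (E : ℝ) : Continuous fun p : ℝ × ℝ => shenRoot E p.1 p.2 := by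
  unfold shenRoot
  fun_prop

namespace ShenRegular

variable {E r s : ℝ}

lemma shenRoot_ne_zero (h : ShenRegular E r s) : shenRoot E r s ≠ 0 := (sqrt_pos.2 h.1).ne'

open Topology in
lemma eventually (h : ShenRegular E r s) : ∀ᶠ p : ℝ × ℝ in 𝓝 (r, s), ShenRegular E p.1 p.2 := by
  have hc : Continuous fun p : ℝ × ℝ => E - p.1 ^ 2 + p.2 ^ 2 := by fun_prop
  have hd : Continuous fun p : ℝ × ℝ => shenRoot E p.1 p.2 - p.2 :=
    (continuous_shenRoot E).sub continuous_snd
  exact (hc.continuousAt.eventually (lt_mem_nhds h.1)).and (hd.continuousAt.eventually_ne h.2)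

lemma hasDerivAt_shenRoot_fst (h : ShenRegular E r s) :
    HasDerivAt (fun t => shenRoot E t s) (-r / shenRoot E r s) r := by
  have := ((((hasDerivAt_id r).pow 2).const_sub E).add_const (s ^ 2)).sqrt h.1.ne'
  refine this.congr_deriv ?_
  have h0 := h.shenRoot_ne_zero
  simp only [shenRoot, id, Pi.pow_apply] at h0 ⊢
  field_simp
  simp

lemma hasDerivAt_shenRoot_snd (h : ShenRegular E r s) :
    HasDerivAt (fun t => shenRoot E r t) (s / shenRoot E r s) s := by
  have := (((hasDerivAt_id s).pow 2).const_add (E - r ^ 2)).sqrt h.1.ne'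
  refine this.congr_deriv ?_
  have h0 := h.shenRoot_ne_zero
  simp only [shenRoot, id, Pi.pow_apply] at h0 ⊢
  field_simp
  simp

lemma hasDerivAt_shenTerm_fst (h : ShenRegular E r s) : HasDerivAt (fun t => shenTerm E t s)
    (r / (shenRoot E r s * (shenRoot E r s - s) ^ 2)) r := by
  have := (hasDerivAt_const r (1 : ℝ)).fun_div (h.hasDerivAt_shenRoot_fst.sub_const s) h.2
  refine this.congr_deriv ?_
  have h0 := h.shenRoot_ne_zero
  have h1 := h.2
  field_simp
  ring

lemma hasDerivAt_shenTerm_snd (h : ShenRegular E r s) : HasDerivAt (fun t => shenTerm E r t)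
    (1 / (shenRoot E r s * (shenRoot E r s - s))) s := by
  have := (hasDerivAt_const s (1 : ℝ)).fun_div (h.hasDerivAt_shenRoot_snd.sub (hasDerivAt_id s)) h.2
  refine this.congr_deriv ?_
  have h0 := h.shenRoot_ne_zero
  have h1 := h.2
  simp only [Pi.sub_apply, id]
  field_simp
  ring

lemma hasDerivAt_shenTerm_snd_fst (h : ShenRegular E r s) :
    HasDerivAt (fun t => 1 / (shenRoot E t s * (shenRoot E t s - s)))
      (r * (2 * shenRoot E r s - s) / (shenRoot E r s ^ 3 * (shenRoot E r s - s) ^ 2)) r := by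
  have h0 := h.shenRoot_ne_zero
  have h1 := h.2
  have := (hasDerivAt_const r (1 : ℝ)).fun_div
    (h.hasDerivAt_shenRoot_fst.fun_mul (h.hasDerivAt_shenRoot_fst.sub_const s)) (mul_ne_zero h0 h1)
  refine this.congr_deriv ?_
  field_simp
  ring

lemma hasDerivAt_shenTerm_snd_snd (h : ShenRegular E r s) :
    HasDerivAt (fun t => 1 / (shenRoot E r t * (shenRoot E r t - t)))
      (1 / shenRoot E r s ^ 3) s := by
  have h0 := h.shenRoot_ne_zero
  have h1 := h.2
  have := (hasDerivAt_const s (1 : ℝ)).fun_div (h.hasDerivAt_shenRoot_snd.fun_mul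
    (h.hasDerivAt_shenRoot_snd.fun_sub (hasDerivAt_id s))) (mul_ne_zero h0 h1)
  refine this.congr_deriv ?_
  simp only [id]
  field_simp
  ring

/-- The derivative of `shenTerm` along `s ∂_r + r ∂_s` is `r` times its square. -/
lemma radial_deriv (h : ShenRegular E r s) :
    s * (r / (shenRoot E r s * (shenRoot E r s - s) ^ 2)) +
      r * (1 / (shenRoot E r s * (shenRoot E r s - s))) = r * shenTerm E r s ^ 2 := by
  have h0 := h.shenRoot_ne_zero
  have h1 := h.2
  unfold shenTerm
  field_simp
  ring

lemma projective_flatness (h : ShenRegular E r s) :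
    r / (shenRoot E r s * (shenRoot E r s - s) ^ 2) -
      s * (r * (2 * shenRoot E r s - s) / (shenRoot E r s ^ 3 * (shenRoot E r s - s) ^ 2)) -
      r * (1 / shenRoot E r s ^ 3) = 0 := by
  have h0 := h.shenRoot_ne_zero
  have h1 := h.2
  field_simp
  ring

end ShenRegular

section shenSolPhi

variable {C D r s : ℝ}

lemma pd1_shenSolPhi (hp : ShenRegular (C + 2 * D) r s) (hm : ShenRegular (C - 2 * D) r s) :
    pd1 (shenSolPhi C D) r s = (1 / 2) *
      (r / (shenRoot (C + 2 * D) r s * (shenRoot (C + 2 * D) r s - s) ^ 2) -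
        r / (shenRoot (C - 2 * D) r s * (shenRoot (C - 2 * D) r s - s) ^ 2)) :=
  ((hp.hasDerivAt_shenTerm_fst.sub hm.hasDerivAt_shenTerm_fst).const_mul (1 / 2)).deriv

lemma pd2_shenSolPhi (hp : ShenRegular (C + 2 * D) r s) (hm : ShenRegular (C - 2 * D) r s) :
    pd2 (shenSolPhi C D) r s = (1 / 2) *
      (1 / (shenRoot (C + 2 * D) r s * (shenRoot (C + 2 * D) r s - s)) -
        1 / (shenRoot (C - 2 * D) r s * (shenRoot (C - 2 * D) r s - s))) :=
  ((hp.hasDerivAt_shenTerm_snd.sub hm.hasDerivAt_shenTerm_snd).const_mul (1 / 2)).deriv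

open Filter Topology in
lemma pd2_shenSolPhi_eventuallyEq (hp : ShenRegular (C + 2 * D) r s)
    (hm : ShenRegular (C - 2 * D) r s) :
    Function.uncurry (pd2 (shenSolPhi C D)) =ᶠ[𝓝 (r, s)] Function.uncurry
      (fun r s => (1 / 2) * (1 / (shenRoot (C + 2 * D) r s * (shenRoot (C + 2 * D) r s - s)) -
        1 / (shenRoot (C - 2 * D) r s * (shenRoot (C - 2 * D) r s - s)))) := by
  filter_upwards [hp.eventually, hm.eventually] with p hp hm using pd2_shenSolPhi hp hm

lemma psiFun_shenSolPhi (hp : ShenRegular (C + 2 * D) r s) (hm : ShenRegular (C - 2 * D) r s)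
    (hr : r ≠ 0) (hφ : shenSolPhi C D r s ≠ 0) :
    psiFun (shenSolPhi C D) r s =
      (1 / 2) * (shenTerm (C + 2 * D) r s + shenTerm (C - 2 * D) r s) := by
  rw [psiFun, div_eq_iff (by positivity), pd1_shenSolPhi hp hm, pd2_shenSolPhi hp hm,
    shenSolPhi_eq]
  linear_combination (1 / 2) * hp.radial_deriv - (1 / 2) * hm.radial_deriv

open Filter Topology in
lemma psiFun_shenSolPhi_eventuallyEq (hp : ShenRegular (C + 2 * D) r s)
    (hm : ShenRegular (C - 2 * D) r s) (hr : r ≠ 0) (hφ : shenSolPhi C D r s ≠ 0) :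
    Function.uncurry (psiFun (shenSolPhi C D)) =ᶠ[𝓝 (r, s)] Function.uncurry
      (fun r s => (1 / 2) * (shenTerm (C + 2 * D) r s + shenTerm (C - 2 * D) r s)) := by
  have hc {E : ℝ} (h : ShenRegular E r s) :
      ContinuousAt (fun p : ℝ × ℝ => shenTerm E p.1 p.2) (r, s) :=
    continuousAt_const.div ((continuous_shenRoot E).sub continuous_snd).continuousAt h.2
  have hcφ : ContinuousAt (fun p : ℝ × ℝ => shenSolPhi C D p.1 p.2) (r, s) :=
    continuousAt_const.mul ((hc hp).sub (hc hm))
  filter_upwards [hp.eventually, hm.eventually, hcφ.eventually_ne hφ,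
    continuousAt_fst.eventually_ne hr] with p hp hm hφ hr using psiFun_shenSolPhi hp hm hr hφ

end shenSolPhi

theorem shenSol_satisfies_PDEs (C D : ℝ) (hD : D ≠ 0) :
    ∀ r s : ℝ, 0 < r → 0 < C + 2 * D - r ^ 2 + s ^ 2 → 0 < C - 2 * D - r ^ 2 + s ^ 2 →
      Real.sqrt (C + 2 * D - r ^ 2 + s ^ 2) - s ≠ 0 →
      Real.sqrt (C - 2 * D - r ^ 2 + s ^ 2) - s ≠ 0 →
      0 < shenSolPhi C D r s →
      (pd1 (shenSolPhi C D) r s - s * pd1 (pd2 (shenSolPhi C D)) r s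
        - r * pd2 (pd2 (shenSolPhi C D)) r s = 0) ∧
      (-(shenSolPhi C D r s) ^ 2 =
        (psiFun (shenSolPhi C D) r s) ^ 2
          - (s * pd1 (psiFun (shenSolPhi C D)) r s
            + r * pd2 (psiFun (shenSolPhi C D)) r s) / r) := by
  intro r s hr hp₀ hm₀ hp₁ hm₁ hφ
  have hp : ShenRegular (C + 2 * D) r s := ⟨hp₀, hp₁⟩
  have hm : ShenRegular (C - 2 * D) r s := ⟨hm₀, hm₁⟩
  constructor
  · have hφs := pd2_shenSolPhi_eventuallyEq hp hm
    have hrs := (pd1_congr hφs).trans ((hp.hasDerivAt_shenTerm_snd_fst.sub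
      hm.hasDerivAt_shenTerm_snd_fst).const_mul (1 / 2)).deriv
    have hss := (pd2_congr hφs).trans ((hp.hasDerivAt_shenTerm_snd_snd.sub
      hm.hasDerivAt_shenTerm_snd_snd).const_mul (1 / 2)).deriv
    rw [hrs, hss, pd1_shenSolPhi hp hm]
    linear_combination (1 / 2) * hp.projective_flatness - (1 / 2) * hm.projective_flatness
  · have hψ := psiFun_shenSolPhi_eventuallyEq hp hm hr.ne' hφ.ne'
    have hψr := (pd1_congr hψ).trans ((hp.hasDerivAt_shenTerm_fst.add
      hm.hasDerivAt_shenTerm_fst).const_mul (1 / 2)).deriv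
    have hψs := (pd2_congr hψ).trans ((hp.hasDerivAt_shenTerm_snd.add
      hm.hasDerivAt_shenTerm_snd).const_mul (1 / 2)).deriv
    have hrad : (s * pd1 (psiFun (shenSolPhi C D)) r s + r * pd2 (psiFun (shenSolPhi C D)) r s) / r
        = (1 / 2) * (shenTerm (C + 2 * D) r s ^ 2 + shenTerm (C - 2 * D) r s ^ 2) := by
      rw [div_eq_iff hr.ne', hψr, hψs]
      linear_combination (1 / 2) * hp.radial_deriv + (1 / 2) * hm.radial_deriv
    rw [hrad, psiFun_shenSolPhi hp hm hr.ne' hφ.ne', shenSolPhi_eq]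
    ring
end

section
/- Let φ(r,s) be a smooth function defined for 0 < r < ρ and s² < r², satisfying φ > 0, φ − s·φ_s > 0 and φ − s·φ_s + (r² − s²)·φ_{ss} > 0 (so that F = |y|·φ(|x|, ⟨x,y⟩/|y|) is a Finsler metric). Then the identity R₄ + s·R₂ = −(φ_s/φ)·( (r² − s²)·R₂ + R₁ ) holds at every point of the region, where R₄ := (1/2)·(3R₃ − ∂_s R₁). -/
open Real

/-- Q := (s·φ_{rs} + r·φ_{ss} − φ_r)/(2r·(φ − s·φ_s + (r² − s²)·φ_{ss})). -/
noncomputable def Qfun (φ : ℝ → ℝ → ℝ) (r s : ℝ) : ℝ :=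
  (s * pd1 (pd2 φ) r s + r * pd2 (pd2 φ) r s - pd1 φ r s) /
    (2 * r * (φ r s - s * pd2 φ r s + (r ^ 2 - s ^ 2) * pd2 (pd2 φ) r s))

/-- P := (s·φ_r + r·φ_s)/(2rφ) − (Q/φ)·(s·φ + (r² − s²)·φ_s). -/
noncomputable def Pfun (φ : ℝ → ℝ → ℝ) (r s : ℝ) : ℝ :=
  (s * pd1 φ r s + r * pd2 φ r s) / (2 * r * φ r s)
    - (Qfun φ r s / φ r s) * (s * φ r s + (r ^ 2 - s ^ 2) * pd2 φ r s)

/-- R₁ := P² − (s·P_r + r·P_s)/r + 2Q·(1 + s·P + (r² − s²)·P_s). -/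
noncomputable def R1fun (φ : ℝ → ℝ → ℝ) (r s : ℝ) : ℝ :=
  (Pfun φ r s) ^ 2 - (s * pd1 (Pfun φ) r s + r * pd2 (Pfun φ) r s) / r
    + 2 * Qfun φ r s * (1 + s * Pfun φ r s + (r ^ 2 - s ^ 2) * pd2 (Pfun φ) r s)

/-- R₂ := (2Q_r − s·Q_{rs} − r·Q_{ss})/r + 2Q·(2Q − s·Q_s) + (r² − s²)·(2Q·Q_{ss} − (Q_s)²). -/
noncomputable def R2fun (φ : ℝ → ℝ → ℝ) (r s : ℝ) : ℝ :=
  (2 * pd1 (Qfun φ) r s - s * pd1 (pd2 (Qfun φ)) r s - r * pd2 (pd2 (Qfun φ)) r s) / r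
    + 2 * Qfun φ r s * (2 * Qfun φ r s - s * pd2 (Qfun φ) r s)
    + (r ^ 2 - s ^ 2) * (2 * Qfun φ r s * pd2 (pd2 (Qfun φ)) r s - (pd2 (Qfun φ) r s) ^ 2)

/-- R₃ := (P_r − s·P_{rs} − r·P_{ss})/r + 2Q·∂_s[1 + s·P + (r² − s²)·P_s]. -/
noncomputable def R3fun (φ : ℝ → ℝ → ℝ) (r s : ℝ) : ℝ :=
  (pd1 (Pfun φ) r s - s * pd1 (pd2 (Pfun φ)) r s - r * pd2 (pd2 (Pfun φ)) r s) / r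
    + 2 * Qfun φ r s *
      pd2 (fun a b => 1 + b * Pfun φ a b + (a ^ 2 - b ^ 2) * pd2 (Pfun φ) a b) r s

/-- R₄ := (1/2)·(3R₃ − ∂_s R₁). -/
noncomputable def R4fun (φ : ℝ → ℝ → ℝ) (r s : ℝ) : ℝ :=
  (1 / 2) * (3 * R3fun φ r s - pd2 (R1fun φ) r s)

theorem hasDerivAt_pd1 {f : ℝ → ℝ → ℝ} {r s : ℝ}
    (hf : DifferentiableAt ℝ (fun p : ℝ × ℝ => f p.1 p.2) (r, s)) :
    HasDerivAt (fun t => f t s) (pd1 f r s) r := by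
  have h : DifferentiableAt ℝ (fun t : ℝ => f t s) r :=
    DifferentiableAt.comp (g := fun p : ℝ × ℝ => f p.1 p.2) (f := fun t : ℝ => (t, s)) r hf
      (by fun_prop)
  exact h.hasDerivAt

theorem hasDerivAt_pd2 {f : ℝ → ℝ → ℝ} {r s : ℝ}
    (hf : DifferentiableAt ℝ (fun p : ℝ × ℝ => f p.1 p.2) (r, s)) :
    HasDerivAt (fun t => f r t) (pd2 f r s) s := by
  have h : DifferentiableAt ℝ (fun t : ℝ => f r t) s :=
    DifferentiableAt.comp (g := fun p : ℝ × ℝ => f p.1 p.2) (f := fun t : ℝ => (r, t)) s hf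
      (by fun_prop)
  exact h.hasDerivAt

theorem pd1_eq_fderiv {f : ℝ → ℝ → ℝ} {r s : ℝ}
    (hf : DifferentiableAt ℝ (fun p : ℝ × ℝ => f p.1 p.2) (r, s)) :
    pd1 f r s = fderiv ℝ (fun p : ℝ × ℝ => f p.1 p.2) (r, s) (1, 0) := by
  have h : HasDerivAt (fun t : ℝ => (t, s)) ((1 : ℝ), (0 : ℝ)) r :=
    (hasDerivAt_id' r).prodMk (hasDerivAt_const r s)
  exact (HasFDerivAt.comp_hasDerivAt (f := fun t : ℝ => (t, s)) r hf.hasFDerivAt h).deriv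

theorem pd2_eq_fderiv {f : ℝ → ℝ → ℝ} {r s : ℝ}
    (hf : DifferentiableAt ℝ (fun p : ℝ × ℝ => f p.1 p.2) (r, s)) :
    pd2 f r s = fderiv ℝ (fun p : ℝ × ℝ => f p.1 p.2) (r, s) (0, 1) := by
  have h : HasDerivAt (fun t : ℝ => (r, t)) ((0 : ℝ), (1 : ℝ)) s :=
    (hasDerivAt_const s r).prodMk (hasDerivAt_id' s)
  exact (HasFDerivAt.comp_hasDerivAt (f := fun t : ℝ => (r, t)) s hf.hasFDerivAt h).deriv

section SmoothOnOpen

variable {U : Set (ℝ × ℝ)} {f : ℝ → ℝ → ℝ}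

theorem ContDiffOn.differentiableAt_uncurried (hU : IsOpen U)
    (hf : ContDiffOn ℝ (⊤ : ℕ∞) (fun p : ℝ × ℝ => f p.1 p.2) U) {p : ℝ × ℝ} (hp : p ∈ U) :
    DifferentiableAt ℝ (fun p : ℝ × ℝ => f p.1 p.2) p :=
  (hf.contDiffAt (hU.mem_nhds hp)).differentiableAt (by simp)

theorem ContDiffOn.fderiv_apply_const (hU : IsOpen U)
    (hf : ContDiffOn ℝ (⊤ : ℕ∞) (fun p : ℝ × ℝ => f p.1 p.2) U) (v : ℝ × ℝ) :
    ContDiffOn ℝ (⊤ : ℕ∞) (fun p => fderiv ℝ (fun p : ℝ × ℝ => f p.1 p.2) p v) U :=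
  (hf.fderiv_of_isOpen hU (m := (⊤ : ℕ∞)) (by simp)).clm_apply contDiffOn_const

theorem ContDiffOn.pd1 (hU : IsOpen U)
    (hf : ContDiffOn ℝ (⊤ : ℕ∞) (fun p : ℝ × ℝ => f p.1 p.2) U) :
    ContDiffOn ℝ (⊤ : ℕ∞) (fun p : ℝ × ℝ => pd1 f p.1 p.2) U :=
  (hf.fderiv_apply_const hU (1, 0)).congr fun _ hp =>
    pd1_eq_fderiv (hf.differentiableAt_uncurried hU hp)

theorem ContDiffOn.pd2 (hU : IsOpen U)
    (hf : ContDiffOn ℝ (⊤ : ℕ∞) (fun p : ℝ × ℝ => f p.1 p.2) U) :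
    ContDiffOn ℝ (⊤ : ℕ∞) (fun p : ℝ × ℝ => pd2 f p.1 p.2) U :=
  (hf.fderiv_apply_const hU (0, 1)).congr fun _ hp =>
    pd2_eq_fderiv (hf.differentiableAt_uncurried hU hp)

theorem ContDiffOn.hasDerivAt_pd1 (hU : IsOpen U)
    (hf : ContDiffOn ℝ (⊤ : ℕ∞) (fun p : ℝ × ℝ => f p.1 p.2) U) {r s : ℝ} (hp : (r, s) ∈ U) :
    HasDerivAt (fun t => f t s) (_root_.pd1 f r s) r :=
  _root_.hasDerivAt_pd1 (hf.differentiableAt_uncurried hU hp)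

theorem ContDiffOn.hasDerivAt_pd2 (hU : IsOpen U)
    (hf : ContDiffOn ℝ (⊤ : ℕ∞) (fun p : ℝ × ℝ => f p.1 p.2) U) {r s : ℝ} (hp : (r, s) ∈ U) :
    HasDerivAt (fun t => f r t) (_root_.pd2 f r s) s :=
  _root_.hasDerivAt_pd2 (hf.differentiableAt_uncurried hU hp)

theorem ContDiffOn.pd1_pd2_comm (hU : IsOpen U)
    (hf : ContDiffOn ℝ (⊤ : ℕ∞) (fun p : ℝ × ℝ => f p.1 p.2) U) {r s : ℝ} (hp : (r, s) ∈ U) :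
    _root_.pd1 (_root_.pd2 f) r s = _root_.pd2 (_root_.pd1 f) r s := by
  have hnhds : U ∈ nhds (r, s) := hU.mem_nhds hp
  have hd : DifferentiableAt ℝ (fderiv ℝ fun p : ℝ × ℝ => f p.1 p.2) (r, s) :=
    ((hf.fderiv_of_isOpen hU (m := (⊤ : ℕ∞)) (by simp)).contDiffAt hnhds).differentiableAt
      (by simp)
  have key : ∀ v w : ℝ × ℝ,
      fderiv ℝ (fun p => fderiv ℝ (fun p : ℝ × ℝ => f p.1 p.2) p v) (r, s) w =
        fderiv ℝ (fderiv ℝ fun p : ℝ × ℝ => f p.1 p.2) (r, s) w v := fun v w => by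
    rw [fderiv_clm_apply hd (differentiableAt_const v)]
    simp
  have e2 : (fun p : ℝ × ℝ => _root_.pd2 f p.1 p.2) =ᶠ[nhds (r, s)]
      fun p => fderiv ℝ (fun p : ℝ × ℝ => f p.1 p.2) p (0, 1) :=
    Filter.eventuallyEq_of_mem hnhds fun _ hq =>
      pd2_eq_fderiv (hf.differentiableAt_uncurried hU hq)
  have e1 : (fun p : ℝ × ℝ => _root_.pd1 f p.1 p.2) =ᶠ[nhds (r, s)]
      fun p => fderiv ℝ (fun p : ℝ × ℝ => f p.1 p.2) p (1, 0) :=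
    Filter.eventuallyEq_of_mem hnhds fun _ hq =>
      pd1_eq_fderiv (hf.differentiableAt_uncurried hU hq)
  rw [pd1_eq_fderiv ((hf.pd2 hU).differentiableAt_uncurried hU hp),
    pd2_eq_fderiv ((hf.pd1 hU).differentiableAt_uncurried hU hp), e1.fderiv_eq, e2.fderiv_eq,
    key, key]
  exact (hf.contDiffAt hnhds).isSymmSndFDerivAt
    (by simpa using WithTop.coe_le_coe.2 (le_top : (2 : ℕ∞) ≤ ⊤)) _ _

theorem hasDerivAt_fst_unique (hU : IsOpen U) {F G : ℝ → ℝ → ℝ}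
    (hFG : ∀ r s, (r, s) ∈ U → F r s = G r s) {r s a b : ℝ} (hp : (r, s) ∈ U)
    (hF : HasDerivAt (fun t => F t s) a r) (hG : HasDerivAt (fun t => G t s) b r) : a = b := by
  have hmem : ∀ᶠ t in nhds r, (t, s) ∈ U :=
    (Continuous.prodMk_left s).continuousAt.eventually (hU.mem_nhds hp)
  exact hF.unique (hG.congr_of_eventuallyEq (hmem.mono fun t ht => hFG t s ht))

theorem hasDerivAt_snd_unique (hU : IsOpen U) {F G : ℝ → ℝ → ℝ}
    (hFG : ∀ r s, (r, s) ∈ U → F r s = G r s) {r s a b : ℝ} (hp : (r, s) ∈ U)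
    (hF : HasDerivAt (fun t => F r t) a s) (hG : HasDerivAt (fun t => G r t) b s) : a = b := by
  have hmem : ∀ᶠ t in nhds s, (r, t) ∈ U :=
    (Continuous.prodMk_right r).continuousAt.eventually (hU.mem_nhds hp)
  exact hF.unique (hG.congr_of_eventuallyEq (hmem.mono fun t ht => hFG r t ht))

theorem hasDerivAt_fst_sq_sub (r s : ℝ) : HasDerivAt (fun t => t ^ 2 - s ^ 2) (2 * r) r := by
  simpa using (hasDerivAt_pow 2 r).sub_const (s ^ 2)

theorem hasDerivAt_snd_sq_sub (r s : ℝ) : HasDerivAt (fun t => r ^ 2 - t ^ 2) (-(2 * s)) s := by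
  simpa using (hasDerivAt_pow 2 s).const_sub (r ^ 2)

end SmoothOnOpen

section SprayCoefficients

variable {U : Set (ℝ × ℝ)} {f P Q : ℝ → ℝ → ℝ}

/-- The radial derivative of `f` in terms of the spray coefficients `P` and `Q`. -/
theorem pd1_eq_of_spray (hU : IsOpen U)
    (hf : ContDiffOn ℝ (⊤ : ℕ∞) (fun p : ℝ × ℝ => f p.1 p.2) U)
    (hP : ContDiffOn ℝ (⊤ : ℕ∞) (fun p : ℝ × ℝ => P p.1 p.2) U)
    (hQ : ContDiffOn ℝ (⊤ : ℕ∞) (fun p : ℝ × ℝ => Q p.1 p.2) U)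
    (eP : ∀ r s, (r, s) ∈ U → s * pd1 f r s + r * pd2 f r s =
      2 * r * (P r s * f r s + Q r s * (s * f r s + (r ^ 2 - s ^ 2) * pd2 f r s)))
    (eQ : ∀ r s, (r, s) ∈ U → s * pd1 (pd2 f) r s + r * pd2 (pd2 f) r s - pd1 f r s =
      2 * r * (Q r s * (f r s - s * pd2 f r s + (r ^ 2 - s ^ 2) * pd2 (pd2 f) r s)))
    (r s : ℝ) (hp : (r, s) ∈ U) :
    pd1 f r s = r * (P r s * pd2 f r s + pd2 P r s * f r s
      + pd2 Q r s * (s * f r s + (r ^ 2 - s ^ 2) * pd2 f r s)) := by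
  have df := hf.hasDerivAt_pd2 hU hp
  have df1 := (hf.pd1 hU).hasDerivAt_pd2 hU hp
  have df2 := (hf.pd2 hU).hasDerivAt_pd2 hU hp
  have h := hasDerivAt_snd_unique hU eP hp
    (((hasDerivAt_id' s).fun_mul df1).fun_add (df2.const_mul r))
    (((((hP.hasDerivAt_pd2 hU hp).fun_mul df).fun_add ((hQ.hasDerivAt_pd2 hU hp).fun_mul
      (((hasDerivAt_id' s).fun_mul df).fun_add ((hasDerivAt_snd_sq_sub r s).fun_mul df2)))).const_mul
        (2 * r)))
  rw [← hf.pd1_pd2_comm hU hp] at h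
  linear_combination (1 / 2) * h - (1 / 2) * eQ r s hp

theorem curvature_identity_of_spray (hU : IsOpen U) (hr : ∀ r s, (r, s) ∈ U → r ≠ 0)
    (hf : ContDiffOn ℝ (⊤ : ℕ∞) (fun p : ℝ × ℝ => f p.1 p.2) U)
    (hP : ContDiffOn ℝ (⊤ : ℕ∞) (fun p : ℝ × ℝ => P p.1 p.2) U)
    (hQ : ContDiffOn ℝ (⊤ : ℕ∞) (fun p : ℝ × ℝ => Q p.1 p.2) U)
    (eP : ∀ r s, (r, s) ∈ U → s * pd1 f r s + r * pd2 f r s =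
      2 * r * (P r s * f r s + Q r s * (s * f r s + (r ^ 2 - s ^ 2) * pd2 f r s)))
    (eQ : ∀ r s, (r, s) ∈ U → s * pd1 (pd2 f) r s + r * pd2 (pd2 f) r s - pd1 f r s =
      2 * r * (Q r s * (f r s - s * pd2 f r s + (r ^ 2 - s ^ 2) * pd2 (pd2 f) r s)))
    (r s : ℝ) (hp : (r, s) ∈ U) :
    f r s * (2 * pd1 P r s / r - (s * pd1 (pd2 P) r s / r + pd2 (pd2 P) r s)
        + 2 * Q r s * (P r s - s * pd2 P r s + (r ^ 2 - s ^ 2) * pd2 (pd2 P) r s)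
        - P r s * pd2 P r s
        - pd2 Q r s * (1 + s * P r s + (r ^ 2 - s ^ 2) * pd2 P r s))
      + (s * f r s + (r ^ 2 - s ^ 2) * pd2 f r s) *
        ((2 * pd1 Q r s - s * pd1 (pd2 Q) r s - r * pd2 (pd2 Q) r s) / r
          + 2 * Q r s * (2 * Q r s - s * pd2 Q r s)
          + (r ^ 2 - s ^ 2) * (2 * Q r s * pd2 (pd2 Q) r s - (pd2 Q r s) ^ 2))
      + pd2 f r s * ((P r s) ^ 2 - (s * pd1 P r s + r * pd2 P r s) / r
          + 2 * Q r s * (1 + s * P r s + (r ^ 2 - s ^ 2) * pd2 P r s)) = 0 := by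
  have eA := pd1_eq_of_spray hU hf hP hQ eP eQ
  have eC : ∀ r s, (r, s) ∈ U →
      s * (P r s * pd2 f r s + pd2 P r s * f r s
        + pd2 Q r s * (s * f r s + (r ^ 2 - s ^ 2) * pd2 f r s)) + pd2 f r s =
      2 * (P r s * f r s + Q r s * (s * f r s + (r ^ 2 - s ^ 2) * pd2 f r s)) := fun r s hp =>
    mul_left_cancel₀ (hr r s hp) (by linear_combination eP r s hp - s * eA r s hp)
  have hr0 := hr r s hp
  have sf := (hf.hasDerivAt_pd2 hU hp)
  have sf1 := ((hf.pd1 hU).hasDerivAt_pd2 hU hp)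
  have sf2 := ((hf.pd2 hU).hasDerivAt_pd2 hU hp)
  have sP := (hP.hasDerivAt_pd2 hU hp)
  have sP2 := ((hP.pd2 hU).hasDerivAt_pd2 hU hp)
  have sQ := (hQ.hasDerivAt_pd2 hU hp)
  have sQ2 := ((hQ.pd2 hU).hasDerivAt_pd2 hU hp)
  have rf := (hf.hasDerivAt_pd1 hU hp)
  have rf2 := ((hf.pd2 hU).hasDerivAt_pd1 hU hp)
  have rP := (hP.hasDerivAt_pd1 hU hp)
  have rP2 := ((hP.pd2 hU).hasDerivAt_pd1 hU hp)
  have rQ := (hQ.hasDerivAt_pd1 hU hp)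
  have rQ2 := ((hQ.pd2 hU).hasDerivAt_pd1 hU hp)
  have sS := ((hasDerivAt_id' s).fun_mul sf).fun_add ((hasDerivAt_snd_sq_sub r s).fun_mul sf2)
  have rS := (rf.const_mul s).fun_add ((hasDerivAt_fst_sq_sub r s).fun_mul rf2)
  have sa := ((sP.fun_mul sf2).fun_add (sP2.fun_mul sf)).fun_add (sQ2.fun_mul sS)
  have ra := ((rP.fun_mul rf2).fun_add (rP2.fun_mul rf)).fun_add (rQ2.fun_mul rS)
  have As := hasDerivAt_snd_unique hU eA hp sf1 (sa.const_mul r)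
  have Cs := hasDerivAt_snd_unique hU eC hp (((hasDerivAt_id' s).fun_mul sa).fun_add sf2)
    (((sP.fun_mul sf).fun_add (sQ.fun_mul sS)).const_mul 2)
  have Cr := hasDerivAt_fst_unique hU eC hp ((ra.const_mul s).fun_add rf2)
    (((rP.fun_mul rf).fun_add (rQ.fun_mul rS)).const_mul 2)
  have A := eA r s hp
  have C := eC r s hp
  rw [← hf.pd1_pd2_comm hU hp] at As
  rw [As, A] at Cr
  field_simp
  linear_combination -Cr + r * (P r s + (r ^ 2 - s ^ 2) * pd2 Q r s) * Cs
    + r * (pd2 P r s + s * pd2 Q r s - 2 * Q r s) * C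

end SprayCoefficients

/-- Equation (Req2) of the paper: R₄ + s·R₂ = −(φ_s/φ)·((r² − s²)·R₂ + R₁),
a consequence of the symmetry g_{ik}Rⁱ_j = g_{ij}Rⁱ_k of the Riemann curvature. -/
theorem Req2_identity (ρ : ℝ) (φ : ℝ → ℝ → ℝ)
    (hsmooth : ContDiffOn ℝ (⊤ : ℕ∞) (fun p : ℝ × ℝ => φ p.1 p.2)
      {p : ℝ × ℝ | 0 < p.1 ∧ p.1 < ρ ∧ p.2 ^ 2 < p.1 ^ 2})
    (hpos : ∀ r s : ℝ, 0 < r → r < ρ → s ^ 2 < r ^ 2 → 0 < φ r s)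
    (h1 : ∀ r s : ℝ, 0 < r → r < ρ → s ^ 2 < r ^ 2 → 0 < φ r s - s * pd2 φ r s)
    (h2 : ∀ r s : ℝ, 0 < r → r < ρ → s ^ 2 < r ^ 2 →
      0 < φ r s - s * pd2 φ r s + (r ^ 2 - s ^ 2) * pd2 (pd2 φ) r s) :
    ∀ r s : ℝ, 0 < r → r < ρ → s ^ 2 < r ^ 2 →
      R4fun φ r s + s * R2fun φ r s =
        -(pd2 φ r s / φ r s) * ((r ^ 2 - s ^ 2) * R2fun φ r s + R1fun φ r s) := by
  have hU : IsOpen {p : ℝ × ℝ | 0 < p.1 ∧ p.1 < ρ ∧ p.2 ^ 2 < p.1 ^ 2} :=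
    (isOpen_lt continuous_const continuous_fst).inter
      ((isOpen_lt continuous_fst continuous_const).inter
        (isOpen_lt (continuous_snd.pow 2) (continuous_fst.pow 2)))
  set U := {p : ℝ × ℝ | 0 < p.1 ∧ p.1 < ρ ∧ p.2 ^ 2 < p.1 ^ 2}
  have hr : ∀ r s, (r, s) ∈ U → r ≠ 0 := fun r s hp => hp.1.ne'
  have hφ : ∀ r s, (r, s) ∈ U → φ r s ≠ 0 := fun r s hp => (hpos r s hp.1 hp.2.1 hp.2.2).ne'
  have hD : ∀ r s, (r, s) ∈ U →
      φ r s - s * pd2 φ r s + (r ^ 2 - s ^ 2) * pd2 (pd2 φ) r s ≠ 0 := fun r s hp =>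
    (h2 r s hp.1 hp.2.1 hp.2.2).ne'
  have s1 := hsmooth.pd1 hU
  have s2 := hsmooth.pd2 hU
  have s12 := s2.pd1 hU
  have s22 := s2.pd2 hU
  have cfst : ContDiffOn ℝ (⊤ : ℕ∞) (fun p : ℝ × ℝ => p.1) U := contDiffOn_fst
  have csnd : ContDiffOn ℝ (⊤ : ℕ∞) (fun p : ℝ × ℝ => p.2) U := contDiffOn_snd
  have cw := (cfst.pow 2).sub (csnd.pow 2)
  have c2r := (contDiffOn_const (c := (2 : ℝ))).mul cfst
  have hQ : ContDiffOn ℝ (⊤ : ℕ∞) (fun p : ℝ × ℝ => Qfun φ p.1 p.2) U :=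
    (((csnd.mul s12).add (cfst.mul s22)).sub s1).div
      (c2r.mul ((hsmooth.sub (csnd.mul s2)).add (cw.mul s22)))
      fun p hp => mul_ne_zero (mul_ne_zero two_ne_zero (hr p.1 p.2 hp)) (hD p.1 p.2 hp)
  have hP : ContDiffOn ℝ (⊤ : ℕ∞) (fun p : ℝ × ℝ => Pfun φ p.1 p.2) U :=
    (((csnd.mul s1).add (cfst.mul s2)).div (c2r.mul hsmooth)
      fun p hp => mul_ne_zero (mul_ne_zero two_ne_zero (hr p.1 p.2 hp)) (hφ p.1 p.2 hp)).sub
      ((hQ.div hsmooth fun p hp => hφ p.1 p.2 hp).mul ((csnd.mul hsmooth).add (cw.mul s2)))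
  intro r s hr0 hrρ hs
  have hp : (r, s) ∈ U := ⟨hr0, hrρ, hs⟩
  have key := curvature_identity_of_spray hU hr hsmooth hP hQ
    (fun r s hp => by
      have := hr r s hp
      have := hφ r s hp
      rw [Pfun]
      field_simp
      ring)
    (fun r s hp => by
      rw [Qfun, ← mul_assoc, mul_comm (2 * r), mul_assoc,
        div_mul_cancel₀ _ (mul_ne_zero (mul_ne_zero two_ne_zero (hr r s hp)) (hD r s hp))])
    r s hp
  have sP := hP.hasDerivAt_pd2 hU hp
  have sP2 := (hP.pd2 hU).hasDerivAt_pd2 hU hp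
  have sP1 := (hP.pd1 hU).hasDerivAt_pd2 hU hp
  have sQ := hQ.hasDerivAt_pd2 hU hp
  have sB := (((hasDerivAt_id' s).fun_mul sP).const_add 1).fun_add
    ((hasDerivAt_snd_sq_sub r s).fun_mul sP2)
  have eB : pd2 (fun a b => 1 + b * Pfun φ a b + (a ^ 2 - b ^ 2) * pd2 (Pfun φ) a b) r s = _ :=
    sB.deriv
  have eR1 : pd2 (R1fun φ) r s = _ :=
    (((sP.fun_pow 2).fun_sub
      ((((hasDerivAt_id' s).fun_mul sP1).fun_add (sP2.const_mul r)).div_const r)).fun_add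
        ((sQ.const_mul 2).fun_mul sB)).deriv
  have hf0 := hφ r s hp
  rw [← hP.pd1_pd2_comm hU hp] at eR1
  rw [R4fun, R3fun, eB, eR1, R2fun, R1fun]
  field_simp at key ⊢
  linear_combination 2 * key
end
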